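/- There exists a universal constant C > 0 such that the following holds. Let 𝒵 be a nonempty finite set, m ≥ 2, and let Z be a random vector on 𝒵^m whose probability mass function is strictly positive on 𝒵^m and whose log-coefficient satisfies α_log(Z) < 1/2. Let 𝒢 be a nonempty countable class of functions 𝒵 → ℝ that is uniformly bounded. Then E_{S∼Z}[ sup_{g∈𝒢} ( (1/m) Σ_{i=1}^m g(s_i) − E_{S∼Z}[ (1/m) Σ_{i=1}^m g(s_i) ] ) ] ≤ C · 𝔊_Z(𝒢) / √(1 − 2 α_log(Z)). (The m marginal distributions of Z are not assumed to be identical.) -/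

import Mathlib

open Classical MeasureTheory ProbabilityTheory
noncomputable section

/-- The configuration obtained from `z` by replacing the `i`-th coordinate with `a`
and the `j`-th coordinate with `b`. -/
def updTwo {Z : Type*} {m : ℕ} (z : Fin m → Z) (i : Fin m) (a : Z) (j : Fin m) (b : Z) :
    Fin m → Z :=
  Function.update (Function.update z i a) j b

/-- The log-influence `I^log_{j,i}` between coordinates `j` and `i` of a random vector on
`𝒵^m` with probability mass function `p`. -/
def logInfluence {Z : Type*} [Fintype Z] {m : ℕ} (p : (Fin m → Z) → ℝ) (i j : Fin m) : ℝ :=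
  (1 / 4) * ⨆ w : (Fin m → Z) × Z × Z × Z × Z,
    Real.log (p (updTwo w.1 i w.2.1 j w.2.2.1) * p (updTwo w.1 i w.2.2.2.1 j w.2.2.2.2) /
      (p (updTwo w.1 i w.2.2.2.1 j w.2.2.1) * p (updTwo w.1 i w.2.1 j w.2.2.2.2)))

/-- The log-coefficient `α_log` of a random vector on `𝒵^m` with probability mass function
`p`: the maximum over `i` of `∑_{j ≠ i} I^log_{j,i}`. -/
def logCoefficient {Z : Type*} [Fintype Z] {m : ℕ} (p : (Fin m → Z) → ℝ) : ℝ :=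
  ⨆ i : Fin m, ∑ j ∈ Finset.univ.erase i, logInfluence p i j

/-- The Gaussian complexity `𝔊_Z(𝒢)` of a countable class `𝒢 = {G n : n ∈ ℕ}` of real-valued
functions on `𝒵`, with respect to the random vector on `𝒵^m` with probability mass function
`p`:  `E_{S∼Z} E_γ [ sup_{g∈𝒢} (1/m) ∑ᵢ γᵢ g(sᵢ) ]`, where the `γᵢ` are i.i.d. standard
Gaussians independent of `S`. -/
def gaussianComplexity {Z : Type*} [Fintype Z] {m : ℕ} (p : (Fin m → Z) → ℝ)
    (G : ℕ → Z → ℝ) : ℝ :=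
  ∑ s : Fin m → Z, p s *
    ∫ γ : Fin m → ℝ, (⨆ n : ℕ, (m : ℝ)⁻¹ * ∑ i, γ i * G n (s i))
      ∂(Measure.pi fun _ : Fin m => gaussianReal 0 1)

/-- The law of a centred Gaussian vector with independent coordinates of variances `r i`. -/
def diagGaussian {ι : Type*} [Fintype ι] (r : ι → ℝ) : Measure (ι → ℝ) :=
  Measure.pi fun i => gaussianReal 0 (r i).toNNReal

instance {ι : Type*} [Fintype ι] (r : ι → ℝ) : IsProbabilityMeasure (diagGaussian r) := by
  unfold diagGaussian; infer_instance

lemma integrable_id_diagGaussian {ι : Type*} [Fintype ι] (r : ι → ℝ) :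
    Integrable id (diagGaussian r) :=
  Integrable.of_eval fun _ => integrable_comp_eval (f := id) IsGaussian.integrable_id

lemma strongDual_pi_apply {ι : Type*} [Fintype ι] [DecidableEq ι] (L : StrongDual ℝ (ι → ℝ))
    (x : ι → ℝ) : L x = ∑ i, L (Pi.single i 1) * x i := by
  conv_lhs => rw [pi_eq_sum_univ' x]
  rw [map_sum]
  refine Finset.sum_congr rfl fun i _ => ?_
  rw [map_smul, smul_eq_mul, mul_comm]

lemma charFunDual_gaussianReal_zero (v : NNReal) (L : StrongDual ℝ ℝ) :
    charFunDual (gaussianReal 0 v) L = Complex.exp ((-(v * L 1 ^ 2) / 2 : ℝ) : ℂ) := by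
  have hL : (⇑L : ℝ → ℝ) = fun x => L 1 * x := by
    ext x
    have := L.map_smul x 1
    simp only [smul_eq_mul, mul_one] at this
    rw [this, mul_comm]
  rw [charFunDual_eq_charFun_map_one, hL, gaussianReal_map_const_mul, charFun_gaussianReal]
  congr 1
  simp
  ring

lemma charFunDual_diagGaussian {ι : Type*} [Fintype ι] [DecidableEq ι] {r : ι → ℝ}
    (hr : ∀ i, 0 ≤ r i) (L : StrongDual ℝ (ι → ℝ)) :
    charFunDual (diagGaussian r) L
      = Complex.exp ((-(∑ i, r i * L (Pi.single i 1) ^ 2) / 2 : ℝ) : ℂ) := by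
  rw [diagGaussian, charFunDual_pi]
  simp_rw [charFunDual_gaussianReal_zero]
  rw [← Complex.exp_sum, ← Complex.ofReal_sum]
  congr 2
  rw [← Finset.sum_neg_distrib, Finset.sum_div]
  refine Finset.sum_congr rfl fun i _ => ?_
  simp [hr i]

lemma map_diagGaussian {ι κ : Type*} [Fintype ι] [DecidableEq ι] [Fintype κ] {r : ι → ℝ}
    {s : κ → ℝ} (hr : ∀ i, 0 ≤ r i) (hs : ∀ i, 0 ≤ s i) (T : (ι → ℝ) →L[ℝ] (κ → ℝ))
    (h : ∀ l : κ → ℝ, ∑ i, r i * (∑ j, l j * T (Pi.single i 1) j) ^ 2 = ∑ j, s j * l j ^ 2) :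
    (diagGaussian r).map T = diagGaussian s := by
  have : IsProbabilityMeasure ((diagGaussian r).map T) :=
    Measure.isProbabilityMeasure_map (by fun_prop)
  refine Measure.ext_of_charFunDual ?_
  ext L
  rw [charFunDual_map, charFunDual_diagGaussian hr, charFunDual_diagGaussian hs,
    ← h fun j => L (Pi.single j 1)]
  simp only [ContinuousLinearMap.comp_apply, ← strongDual_pi_apply]

lemma diagGaussian_map_real {ι : Type*} [Fintype ι] [DecidableEq ι] {r : ι → ℝ}
    (hr : ∀ i, 0 ≤ r i) (T : StrongDual ℝ (ι → ℝ)) :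
    (diagGaussian r).map T = gaussianReal 0 (∑ i, r i * T (Pi.single i 1) ^ 2).toNNReal := by
  have : IsProbabilityMeasure ((diagGaussian r).map T) :=
    Measure.isProbabilityMeasure_map (by fun_prop)
  refine Measure.ext_of_charFunDual ?_
  ext L
  rw [charFunDual_map, charFunDual_diagGaussian hr, charFunDual_gaussianReal_zero,
    Real.coe_toNNReal _ (Finset.sum_nonneg fun i _ => mul_nonneg (hr i) (sq_nonneg _)),
    Finset.sum_mul]
  congr 4
  refine Finset.sum_congr rfl fun i _ => ?_
  have := L.map_smul (T (Pi.single i 1)) 1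
  simp only [smul_eq_mul, mul_one] at this
  rw [ContinuousLinearMap.comp_apply, this]
  ring

lemma diagGaussian_conv {ι : Type*} [Fintype ι] {r s : ι → ℝ}
    (hr : ∀ i, 0 ≤ r i) (hs : ∀ i, 0 ≤ s i) :
    diagGaussian r ∗ diagGaussian s = diagGaussian (r + s) := by
  refine Measure.ext_of_charFunDual ?_
  ext L
  rw [charFunDual_conv, charFunDual_diagGaussian hr, charFunDual_diagGaussian hs,
    charFunDual_diagGaussian (r := r + s) fun i => add_nonneg (hr i) (hs i), ← Complex.exp_add,
    ← Complex.ofReal_add]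
  congr 2
  simp only [Pi.add_apply, add_mul, Finset.sum_add_distrib]
  ring

/-- Convex functions which are globally Lipschitz. -/
structure ConvexLipschitz {E : Type*} [NormedAddCommGroup E] [NormedSpace ℝ E] (f : E → ℝ) :
    Prop where
  convex : ConvexOn ℝ Set.univ f
  lipschitz : ∃ K, LipschitzWith K f

namespace ConvexLipschitz

variable {E F : Type*} [NormedAddCommGroup E] [NormedSpace ℝ E] [NormedAddCommGroup F]
  [NormedSpace ℝ F] {f : E → ℝ}

lemma continuous (hf : ConvexLipschitz f) : Continuous f :=
  hf.lipschitz.choose_spec.continuous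

lemma comp_add_const (hf : ConvexLipschitz f) (a : E) : ConvexLipschitz fun x => f (x + a) where
  convex := by simpa using! hf.convex.translate_right (c := a) |>.congr (fun x _ => by simp [add_comm])
  lipschitz := hf.lipschitz.imp fun K hK => by
    simpa [Function.comp_def] using hK.comp (LipschitzWith.id.add (LipschitzWith.const a))

lemma comp_clm (hf : ConvexLipschitz f) (T : F →L[ℝ] E) : ConvexLipschitz fun x => f (T x) where
  convex := by simpa using! hf.convex.comp_linearMap (T : F →ₗ[ℝ] E)
  lipschitz := let ⟨_, hK⟩ := hf.lipschitz; ⟨_, hK.comp T.lipschitz⟩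

lemma integrable [MeasurableSpace E] [BorelSpace E] [SecondCountableTopology E]
    (hf : ConvexLipschitz f) {μ : Measure E} [IsFiniteMeasure μ] (hμ : Integrable id μ) :
    Integrable f μ := by
  obtain ⟨K, hK⟩ := hf.lipschitz
  have h1 : Integrable (fun x : E => ‖x‖) μ := hμ.norm
  refine ((h1.const_mul (K : ℝ)).add (integrable_const |f 0|)).mono'
    hf.continuous.aestronglyMeasurable (ae_of_all _ fun x => ?_)
  have := hK.dist_le_mul x 0
  rw [Real.dist_eq, dist_zero_right] at this
  rw [Real.norm_eq_abs]
  have h2 := abs_sub_abs_le_abs_sub (f x) (f 0)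
  simp only [Pi.add_apply]
  linarith

lemma midpoint_le (hf : ConvexLipschitz f) (x y z : E) (h : x + y = (2 : ℝ) • z) :
    2 * f z ≤ f x + f y := by
  have := hf.convex.2 (Set.mem_univ x) (Set.mem_univ y) (show (0 : ℝ) ≤ 1 / 2 by norm_num)
    (show (0 : ℝ) ≤ 1 / 2 by norm_num) (by norm_num)
  rw [← smul_add, h, smul_smul] at this
  norm_num at this
  linarith

/-- A segment inequality along a line through the origin. -/
lemma chord_le (hf : ConvexLipschitz f) (v : E) {t a : ℝ} (ha : 0 < a) (ht : |t| ≤ a) :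
    f (t • v) ≤ (a + t) / (2 * a) * f (a • v) + (a - t) / (2 * a) * f (-a • v) := by
  obtain ⟨h1, h2⟩ := abs_le.1 ht
  have := hf.convex.2 (Set.mem_univ (a • v)) (Set.mem_univ (-a • v))
    (show 0 ≤ (a + t) / (2 * a) from div_nonneg (by linarith) (by linarith))
    (show 0 ≤ (a - t) / (2 * a) from div_nonneg (by linarith) (by linarith))
    (by field_simp; ring)
  rw [smul_smul, smul_smul, ← add_smul] at this
  have h3 : (a + t) / (2 * a) * a + (a - t) / (2 * a) * -a = t := by
    field_simp
    ring
  rwa [h3] at this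

end ConvexLipschitz

/-- The first absolute moment of a standard Gaussian. -/
def gaussianAbsMoment : ℝ := ∫ t, |t| ∂gaussianReal 0 1

lemma integrable_id_gaussianReal' (v : NNReal) : Integrable (fun t : ℝ => t) (gaussianReal 0 v) :=
  IsGaussian.integrable_id (μ := gaussianReal 0 v)

lemma gaussianAbsMoment_pos : 0 < gaussianAbsMoment := by
  have : NullSingletonClass (gaussianReal 0 1) := nullSingletonClass_gaussianReal one_ne_zero
  rw [gaussianAbsMoment, integral_pos_iff_support_of_nonneg (fun t => abs_nonneg t)
    (integrable_id_gaussianReal' 1).abs]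
  have : Function.support (fun t : ℝ => |t|) = {0}ᶜ := by ext; simp
  rw [this, prob_compl_eq_one_sub (measurableSet_singleton 0), measure_singleton]
  simp

lemma integral_abs_gaussianReal (v : NNReal) :
    ∫ t, |t| ∂gaussianReal 0 v = Real.sqrt v * gaussianAbsMoment := by
  have h : (gaussianReal 0 1).map (fun t => Real.sqrt v * t) = gaussianReal 0 v := by
    rw [gaussianReal_map_const_mul]
    congr 1
    · simp
    · ext; simp
  rw [← h, integral_map (by fun_prop) (by fun_prop), gaussianAbsMoment, ← integral_const_mul]
  simp [abs_mul, abs_of_nonneg (Real.sqrt_nonneg _)]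

lemma ConvexLipschitz.two_point_le_gaussianReal {E : Type*} [NormedAddCommGroup E]
    [NormedSpace ℝ E] {f : E → ℝ} (hf : ConvexLipschitz f) (v : E) {V : NNReal}
    (hV : 2 ≤ Real.sqrt V * gaussianAbsMoment) :
    (f ((2 : ℝ) • v) + f (-(2 : ℝ) • v)) / 2 ≤ ∫ t : ℝ, f (t • v) ∂gaussianReal 0 V := by
  have h1 : ConvexLipschitz fun t : ℝ => f (t • v) :=
    hf.comp_clm (ContinuousLinearMap.toSpanSingleton ℝ v)
  have h2 : ConvexLipschitz fun t : ℝ => f (-t • v) :=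
    h1.comp_clm (-ContinuousLinearMap.id ℝ ℝ)
  have i1 := h1.integrable (integrable_id_gaussianReal' V)
  have i2 := h2.integrable (integrable_id_gaussianReal' V)
  have hneg : ∫ t : ℝ, f (-t • v) ∂gaussianReal 0 V = ∫ t : ℝ, f (t • v) ∂gaussianReal 0 V := by
    have := gaussianReal_map_neg (μ := 0) (v := V)
    rw [neg_zero] at this
    conv_rhs => rw [← this]
    rw [integral_map (by fun_prop) h1.continuous.aestronglyMeasurable]
  set h : ℝ → ℝ := fun t => f (t • v) + f (-t • v) with hh
  have habs : ∀ t, h |t| = h t := fun t => by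
    rcases abs_choice t with ht | ht <;> simp [hh, ht, add_comm]
  have hint : Integrable h (gaussianReal 0 V) := i1.add i2
  have hcont : Continuous h := h1.continuous.add h2.continuous
  have hJ : h (∫ t, |t| ∂gaussianReal 0 V) ≤ ∫ t, h |t| ∂gaussianReal 0 V :=
    ConvexOn.map_integral_le (h1.convex.add h2.convex) hcont.continuousOn
      isClosed_univ (by simp) (integrable_id_gaussianReal' V).abs
      (hint.congr (ae_of_all _ fun t => (habs t).symm))
  simp_rw [habs] at hJ
  rw [integral_abs_gaussianReal, integral_add i1 i2, hneg] at hJ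
  generalize Real.sqrt V * gaussianAbsMoment = a at *
  have ha : 0 < a := by linarith
  have c1 := hf.chord_le v ha (t := 2) (by rw [abs_of_pos two_pos]; exact hV)
  have c2 := hf.chord_le v ha (t := -2) (by rw [abs_neg, abs_of_pos two_pos]; exact hV)
  have e : (a + 2) / (2 * a) + (a - 2) / (2 * a) = 1 := by field_simp; ring
  have : f ((2 : ℝ) • v) + f (-(2 : ℝ) • v) ≤ h a := by
    have e2 : (a + -2) / (2 * a) = (a - 2) / (2 * a) := by ring
    have e3 : (a - -2) / (2 * a) = (a + 2) / (2 * a) := by ring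
    rw [e2, e3] at c2
    simp only [hh]
    linear_combination c1 + c2 + (f (a • v) + f (-a • v)) * e
  linarith

lemma ConvexLipschitz.line_le_diagGaussian {ι : Type*} [Fintype ι] [DecidableEq ι]
    {f : (ι → ℝ) → ℝ} (hf : ConvexLipschitz f) {s v : ι → ℝ} (hs : ∀ i, 0 ≤ s i)
    (hv : ∀ i, s i = 0 → v i = 0) (hq : 0 < ∑ i, v i ^ 2 / s i) :
    ∫ t : ℝ, f (t • v) ∂gaussianReal 0 (∑ i, v i ^ 2 / s i)⁻¹.toNNReal
      ≤ ∫ x, f x ∂diagGaussian s := by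
  set q := ∑ i, v i ^ 2 / s i with hqdef
  let η : StrongDual ℝ (ι → ℝ) :=
    ∑ i, (v i / s i / q) • ContinuousLinearMap.proj (R := ℝ) (φ := fun _ : ι => ℝ) i
  have hη : ∀ x, η x = ∑ i, v i / s i / q * x i := fun x => by
    simp [η]
  have hηs : ∀ i, η (Pi.single i 1) = v i / s i / q := fun i => by
    simp [hη, Pi.single_apply]
  let T : (ι → ℝ) →L[ℝ] (ι → ℝ) :=
    (2 : ℝ) • η.smulRight v - ContinuousLinearMap.id ℝ (ι → ℝ)
  have hT : ∀ x, T x = (2 : ℝ) • (η x • v) - x := fun x => by simp [T]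
  have hs1 : ∀ i, s i * (v i / s i) = v i := fun i => by
    by_cases h : s i = 0
    · simp [h, hv i h]
    · field_simp
  have hs2 : ∀ i, v i * (v i / s i) = v i ^ 2 / s i := fun i => by ring
  have hmapT : (diagGaussian s).map T = diagGaussian s := by
    refine map_diagGaussian hs hs T fun l => ?_
    have : ∀ i, ∑ j, l j * T (Pi.single i 1) j = 2 * (v i / s i / q) * (∑ j, l j * v j) - l i := by
      intro i
      simp only [hT, hηs, Pi.sub_apply, Pi.smul_apply, smul_eq_mul, mul_sub,
        Finset.sum_sub_distrib, Finset.mul_sum]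
      congr 1
      · exact Finset.sum_congr rfl fun j _ => by ring
      · simp [Pi.single_apply]
    simp_rw [this]
    set M := ∑ j, l j * v j with hM
    have : ∀ i, s i * (2 * (v i / s i / q) * M - l i) ^ 2
        = 4 * M ^ 2 / q ^ 2 * (v i ^ 2 / s i) - 4 * M / q * (l i * v i) + s i * l i ^ 2 := by
      intro i
      rw [← hs2 i]
      calc _ = 4 * M ^ 2 / q ^ 2 * ((s i * (v i / s i)) * (v i / s i))
            - 4 * M / q * (l i * (s i * (v i / s i))) + s i * l i ^ 2 := by ring
        _ = _ := by rw [hs1]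
    simp_rw [this]
    rw [Finset.sum_add_distrib, Finset.sum_sub_distrib, ← Finset.mul_sum, ← Finset.mul_sum,
      ← hqdef, ← hM]
    field_simp
    ring
  have hmapη : (diagGaussian s).map η = gaussianReal 0 q⁻¹.toNNReal := by
    rw [diagGaussian_map_real hs]
    congr 2
    simp_rw [hηs]
    have : ∀ i, s i * (v i / s i / q) ^ 2 = (q ^ 2)⁻¹ * (v i ^ 2 / s i) := by
      intro i
      rw [← hs2 i]
      calc _ = (q ^ 2)⁻¹ * ((s i * (v i / s i)) * (v i / s i)) := by ring
        _ = _ := by rw [hs1]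
    simp_rw [this]
    rw [← Finset.mul_sum, ← hqdef]
    field_simp
  have hline : ConvexLipschitz fun t : ℝ => f (t • v) :=
    hf.comp_clm (ContinuousLinearMap.toSpanSingleton ℝ v)
  rw [← hmapη, integral_map (by fun_prop) hline.continuous.aestronglyMeasurable]
  have hid := integrable_id_diagGaussian s
  have hrefl : ∫ x, f (T x) ∂diagGaussian s = ∫ x, f x ∂diagGaussian s := by
    conv_rhs => rw [← hmapT]
    rw [integral_map (by fun_prop) hf.continuous.aestronglyMeasurable]
  have hle : ∫ x, 2 * f (η x • v) ∂diagGaussian s ≤ ∫ x, (f x + f (T x)) ∂diagGaussian s := by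
    refine integral_mono (((hline.comp_clm η).integrable hid).const_mul 2)
      ((hf.integrable hid).add ((hf.comp_clm T).integrable hid)) fun x => ?_
    exact hf.midpoint_le _ _ _ (by rw [hT]; abel)
  rw [integral_const_mul, integral_add (hf.integrable hid) ((hf.comp_clm T).integrable hid),
    hrefl] at hle
  linarith

/-- A symmetric two-point law on `±2 v` is dominated, against convex functions, by a diagonal
Gaussian of variances `c² s`, with `c` a universal constant, as soon as `∑ v i ^ 2 / s i ≤ 1`. -/
lemma ConvexLipschitz.two_point_le_diagGaussian {ι : Type*} [Fintype ι] [DecidableEq ι]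
    {f : (ι → ℝ) → ℝ} (hf : ConvexLipschitz f) {s v : ι → ℝ} (hs : ∀ i, 0 ≤ s i)
    (hv : ∀ i, s i = 0 → v i = 0) (hq : 0 < ∑ i, v i ^ 2 / s i) (hq1 : ∑ i, v i ^ 2 / s i ≤ 1) :
    (f ((2 : ℝ) • v) + f (-(2 : ℝ) • v)) / 2
      ≤ ∫ x, f x ∂diagGaussian ((2 / gaussianAbsMoment) ^ 2 • s) := by
  have hκ := gaussianAbsMoment_pos
  have hc : 0 < (2 / gaussianAbsMoment) ^ 2 := by positivity
  have hsum : ∑ i, v i ^ 2 / ((2 / gaussianAbsMoment) ^ 2 • s) i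
      = (∑ i, v i ^ 2 / s i) / (2 / gaussianAbsMoment) ^ 2 := by
    rw [Finset.sum_div]
    exact Finset.sum_congr rfl fun i _ => by
      rw [Pi.smul_apply, smul_eq_mul, div_div, mul_comm]
  refine le_trans ?_ (hf.line_le_diagGaussian (v := v)
    (fun i => by simpa using mul_nonneg hc.le (hs i))
    (fun i hi => hv i (by simpa [hc.ne', hκ.ne'] using hi)) (by rw [hsum]; positivity))
  refine hf.two_point_le_gaussianReal v ?_
  rw [hsum]
  set q := ∑ i, v i ^ 2 / s i
  have : 2 / gaussianAbsMoment
      ≤ Real.sqrt ((q / (2 / gaussianAbsMoment) ^ 2)⁻¹.toNNReal : NNReal) := by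
    refine Real.le_sqrt_of_sq_le ?_
    rw [Real.coe_toNNReal _ (by positivity), inv_div, le_div_iff₀ hq]
    nlinarith
  calc 2 = 2 / gaussianAbsMoment * gaussianAbsMoment := by field_simp
    _ ≤ _ := by gcongr

/-- The sign `±1` attached to a boolean. -/
def boolSign (b : Bool) : ℝ := if b then 1 else -1

section Dobrushin

variable {ι : Type*} [DecidableEq ι]

/-- The conditional probability that the `i`-th coordinate is `true` given the others, for the
law with unnormalised weights `q`. -/
def condProb (q : (ι → Bool) → ℝ) (i : ι) (x : ι → Bool) : ℝ :=
  q (Function.update x i true) / (q (Function.update x i true) + q (Function.update x i false))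

/-- Resampling of the `i`-th coordinate from its conditional law. -/
def resample (q : (ι → Bool) → ℝ) (i : ι) (g : (ι → Bool) → ℝ) (x : ι → Bool) : ℝ :=
  condProb q i x * g (Function.update x i true) +
    (1 - condProb q i x) * g (Function.update x i false)

lemma condProb_update_self (q : (ι → Bool) → ℝ) (i : ι) (x : ι → Bool) (b : Bool) :
    condProb q i (Function.update x i b) = condProb q i x := by
  simp [condProb]

lemma condProb_mem {q : (ι → Bool) → ℝ} (hq : ∀ x, 0 < q x) (i : ι) (x : ι → Bool) :
    0 ≤ condProb q i x ∧ condProb q i x ≤ 1 := by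
  have h1 := hq (Function.update x i true)
  have h2 := hq (Function.update x i false)
  unfold condProb
  exact ⟨by positivity, by rw [div_le_one (by positivity)]; linarith⟩

lemma abs_resample_update_sub_le {q : (ι → Bool) → ℝ} (hq : ∀ x, 0 < q x) {g : (ι → Bool) → ℝ}
    {δ : ι → ℝ} (h : ∀ i x b, |g (Function.update x i b) - g x| ≤ δ i) {i j : ι} (hij : i ≠ j)
    {a : ℝ} {b : Bool} {x : ι → Bool}
    (ha : |condProb q i (Function.update x j b) - condProb q i x| ≤ a) :
    |resample q i g (Function.update x j b) - resample q i g x| ≤ δ j + a * δ i := by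
  obtain ⟨p0, p1⟩ := condProb_mem hq i x
  have ht := h j (Function.update x i true) b
  have hf := h j (Function.update x i false) b
  rw [Function.update_comm hij] at ht hf
  have hi := h i (Function.update (Function.update x j b) i false) true
  rw [Function.update_idem] at hi
  unfold resample
  generalize condProb q i (Function.update x j b) = p' at *
  generalize condProb q i x = p at *
  generalize g (Function.update (Function.update x j b) i true) = t' at *
  generalize g (Function.update (Function.update x j b) i false) = f' at *
  generalize g (Function.update x i true) = t at *
  generalize g (Function.update x i false) = f at *
  calc |p' * t' + (1 - p') * f' - (p * t + (1 - p) * f)|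
      = |p * (t' - t) + (1 - p) * (f' - f) + (p' - p) * (t' - f')| := by ring_nf
    _ ≤ |p * (t' - t)| + |(1 - p) * (f' - f)| + |(p' - p) * (t' - f')| := abs_add_three _ _ _
    _ = p * |t' - t| + (1 - p) * |f' - f| + |p' - p| * |t' - f'| := by
      rw [abs_mul, abs_mul, abs_mul, abs_of_nonneg p0, abs_of_nonneg (sub_nonneg.2 p1)]
    _ ≤ p * δ j + (1 - p) * δ j + a * δ i := by
      have : 0 ≤ 1 - p := by linarith
      have : 0 ≤ a := (abs_nonneg _).trans ha
      gcongr
    _ = _ := by ring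

variable [Fintype ι]

lemma two_mul_sum_update (i : ι) (F : (ι → Bool) → ℝ) :
    2 * ∑ x, F x = ∑ x, (F (Function.update x i true) + F (Function.update x i false)) := by
  have hinv : Function.Involutive fun x : ι → Bool => Function.update x i (!x i) := by
    intro x
    simp
  have h : ∑ x, F (Function.update x i (!x i)) = ∑ x, F x := Equiv.sum_comp hinv.toPerm F
  rw [two_mul]
  nth_rw 2 [← h]
  rw [← Finset.sum_add_distrib]
  refine Finset.sum_congr rfl fun x _ => ?_
  have hx := Function.update_eq_self i x
  cases hxi : x i <;> rw [hxi] at hx <;> simp [hx, add_comm]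

lemma sum_mul_resample {q : (ι → Bool) → ℝ} (hq : ∀ x, 0 < q x) (i : ι) (g : (ι → Bool) → ℝ) :
    ∑ x, q x * resample q i g x = ∑ x, q x * g x := by
  have h : 2 * ∑ x, q x * resample q i g x = 2 * ∑ x, q x * g x := by
    rw [two_mul_sum_update i, two_mul_sum_update i]
    refine Finset.sum_congr rfl fun x _ => ?_
    have h1 := hq (Function.update x i true)
    have h2 := hq (Function.update x i false)
    simp only [resample, condProb_update_self, Function.update_idem]
    unfold condProb
    field_simp
    ring
  linarith

lemma sub_le_sum_of_update_le {g : (ι → Bool) → ℝ} {δ : ι → ℝ}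
    (h : ∀ i x b, |g (Function.update x i b) - g x| ≤ δ i) (x y : ι → Bool) :
    g x - g y ≤ ∑ i, δ i := by
  suffices H : ∀ S : Finset ι, g (S.piecewise x y) - g y ≤ ∑ i ∈ S, δ i by
    simpa using H Finset.univ
  intro S
  induction S using Finset.induction_on with
  | empty => simp
  | insert j S hj ih =>
    rw [Finset.piecewise_insert, Finset.sum_insert hj]
    have := (abs_le.1 (h j (S.piecewise x y) (x j))).2
    linarith

/-- `ρ` controls the difference of the expectations of `μ` and `ν` in terms of oscillations. -/
def IsEstimate (μ ν : (ι → Bool) → ℝ) (ρ : ι → ℝ) : Prop :=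
  ∀ (g : (ι → Bool) → ℝ) (δ : ι → ℝ), (∀ i x b, |g (Function.update x i b) - g x| ≤ δ i) →
    ∑ x, μ x * g x - ∑ x, ν x * g x ≤ ∑ i, ρ i * δ i

lemma isEstimate_one {μ ν : (ι → Bool) → ℝ} (hμ : ∀ x, 0 < μ x) (hν : ∀ x, 0 < ν x)
    (hμ1 : ∑ x, μ x = 1) (hν1 : ∑ x, ν x = 1) : IsEstimate μ ν 1 := by
  intro g δ h
  simp only [Pi.one_apply, one_mul]
  have h1 : ∀ y, ∑ x, μ x * g x ≤ g y + ∑ i, δ i := fun y => by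
    calc ∑ x, μ x * g x ≤ ∑ x, μ x * (g y + ∑ i, δ i) := by
          gcongr with x
          · exact (hμ x).le
          · linarith [sub_le_sum_of_update_le h x y]
      _ = _ := by rw [← Finset.sum_mul, hμ1, one_mul]
  have h2 : ∑ x, ν x * (∑ x, μ x * g x - ∑ i, δ i) ≤ ∑ x, ν x * g x := by
    gcongr with x
    · exact (hν x).le
    · linarith [h1 x]
  rw [← Finset.sum_mul, hν1, one_mul] at h2
  linarith

lemma IsEstimate.update {μ ν : (ι → Bool) → ℝ} (hμ : ∀ x, 0 < μ x) (hν : ∀ x, 0 < ν x)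
    (hν1 : ∑ x, ν x = 1) {A : ι → ι → ℝ} (hA : ∀ i j, 0 ≤ A i j) {b : ι → ℝ}
    (hinf : ∀ i j, i ≠ j → ∀ x c, |condProb μ i (Function.update x j c) - condProb μ i x| ≤ A i j)
    (hb : ∀ i x, |condProb μ i x - condProb ν i x| ≤ b i)
    {ρ : ι → ℝ} (hρ0 : ∀ i, 0 ≤ ρ i) (hρ : IsEstimate μ ν ρ) (i : ι) :
    IsEstimate μ ν (Function.update ρ i (∑ j, A i j * ρ j + b i)) := by
  intro g δ h
  have hδ : ∀ i, 0 ≤ δ i := fun i => (abs_nonneg _).trans (h i (fun _ => true) true)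
  have h1 := hρ (resample μ i g) (Function.update (fun j => δ j + A i j * δ i) i 0) (by
    intro j x c
    by_cases hij : i = j
    · subst hij
      simp [resample, condProb_update_self]
    · rw [Function.update_of_ne (Ne.symm hij)]
      exact abs_resample_update_sub_le hμ h hij (hinf i j hij x c))
  have h2 : ∑ x, ν x * resample μ i g x - ∑ x, ν x * resample ν i g x ≤ b i * δ i := by
    rw [← Finset.sum_sub_distrib]
    calc _ ≤ ∑ x, ν x * (b i * δ i) := by
          refine Finset.sum_le_sum fun x _ => ?_
          rw [← mul_sub]
          refine mul_le_mul_of_nonneg_left ?_ (hν x).le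
          have e : resample μ i g x - resample ν i g x = (condProb μ i x - condProb ν i x) *
              (g (Function.update x i true) - g (Function.update x i false)) := by
            unfold resample; ring
          rw [e]
          have hi := h i (Function.update x i false) true
          rw [Function.update_idem] at hi
          refine (le_abs_self _).trans ?_
          rw [abs_mul]
          exact mul_le_mul (hb i x) hi (abs_nonneg _) ((abs_nonneg _).trans (hb i x))
      _ = _ := by rw [← Finset.sum_mul, hν1, one_mul]
  rw [sum_mul_resample hμ] at h1
  rw [sum_mul_resample hν] at h2
  have h3 : ∑ j, ρ j * Function.update (fun j => δ j + A i j * δ i) i 0 j + b i * δ i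
      ≤ ∑ j, Function.update ρ i (∑ j, A i j * ρ j + b i) j * δ j := by
    rw [← Finset.add_sum_erase _ _ (Finset.mem_univ i),
      ← Finset.add_sum_erase _ (fun j => Function.update ρ i _ j * δ j) (Finset.mem_univ i)]
    simp only [Function.update_self, mul_zero, zero_add]
    have e1 : ∑ j ∈ Finset.univ.erase i, ρ j * Function.update (fun j => δ j + A i j * δ i) i 0 j
        = ∑ j ∈ Finset.univ.erase i, ρ j * δ j
          + (∑ j ∈ Finset.univ.erase i, A i j * ρ j) * δ i := by
      rw [Finset.sum_mul, ← Finset.sum_add_distrib]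
      refine Finset.sum_congr rfl fun j hj => ?_
      rw [Function.update_of_ne (Finset.ne_of_mem_erase hj)]
      ring
    have e2 : ∑ j ∈ Finset.univ.erase i, Function.update ρ i (∑ j, A i j * ρ j + b i) j * δ j
        = ∑ j ∈ Finset.univ.erase i, ρ j * δ j :=
      Finset.sum_congr rfl fun j hj => by rw [Function.update_of_ne (Finset.ne_of_mem_erase hj)]
    rw [e1, e2, ← Finset.add_sum_erase _ (fun j => A i j * ρ j) (Finset.mem_univ i)]
    have := mul_nonneg (mul_nonneg (hA i i) (hρ0 i)) (hδ i)
    linarith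
  linarith

/-- Dobrushin's comparison of two laws on `{±1}^ι`: the differences of the means are controlled
by a subsolution of the linear system `ρ = A ρ + b`. -/
lemma exists_subsolution_mean_sub_le {μ ν : (ι → Bool) → ℝ} (hμ : ∀ x, 0 < μ x)
    (hν : ∀ x, 0 < ν x) (hμ1 : ∑ x, μ x = 1) (hν1 : ∑ x, ν x = 1) {A : ι → ι → ℝ}
    (hA : ∀ i j, 0 ≤ A i j) {b : ι → ℝ} (hb0 : ∀ i, 0 ≤ b i)
    (hinf : ∀ i j, i ≠ j → ∀ x c, |condProb μ i (Function.update x j c) - condProb μ i x| ≤ A i j)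
    (hb : ∀ i x, |condProb μ i x - condProb ν i x| ≤ b i) :
    ∃ ρ : ι → ℝ, (∀ i, 0 ≤ ρ i) ∧ (∀ i, ρ i ≤ ∑ j, A i j * ρ j + b i) ∧
      ∀ i, |∑ x, μ x * boolSign (x i) - ∑ x, ν x * boolSign (x i)| ≤ 2 * ρ i := by
  have hclosed : IsClosed {ρ | IsEstimate μ ν ρ} := by
    simp only [IsEstimate, Set.ofPred_forall]
    refine isClosed_iInter fun g => isClosed_iInter fun δ => isClosed_iInter fun _ => ?_
    exact isClosed_le continuous_const (by fun_prop)
  have hcomp : IsCompact (Set.Icc (0 : ι → ℝ) 1 ∩ {ρ | IsEstimate μ ν ρ}) :=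
    isCompact_Icc.inter_right hclosed
  obtain ⟨ρ, ⟨⟨hρ0, hρ1⟩, hρ⟩, hmin⟩ := hcomp.exists_isMinOn
    ⟨1, ⟨zero_le_one, le_rfl⟩, isEstimate_one hμ hν hμ1 hν1⟩
    (f := fun ρ : ι → ℝ => ∑ i, ρ i) (by fun_prop)
  refine ⟨ρ, hρ0, fun i => ?_, fun i => ?_⟩
  · by_contra! hlt
    set t := ∑ j, A i j * ρ j + b i with ht
    have ht0 : 0 ≤ t :=
      add_nonneg (Finset.sum_nonneg fun j _ => mul_nonneg (hA i j) (hρ0 j)) (hb0 i)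
    have hmem : Function.update ρ i t ∈ Set.Icc (0 : ι → ℝ) 1 ∩ {ρ | IsEstimate μ ν ρ} := by
      refine ⟨⟨fun j => ?_, fun j => ?_⟩, hρ.update hμ hν hν1 hA hinf hb hρ0 i⟩
      · by_cases hj : j = i
        · subst hj; simpa using ht0
        · simpa [hj] using hρ0 j
      · by_cases hj : j = i
        · subst hj; simpa using hlt.le.trans (hρ1 j)
        · simpa [hj] using hρ1 j
    have hle : ∑ j, ρ j ≤ ∑ j, Function.update ρ i t j := hmin hmem
    have hlt' : ∑ j, Function.update ρ i t j < ∑ j, ρ j := by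
      refine Finset.sum_lt_sum (fun j _ => ?_) ⟨i, Finset.mem_univ i, by simpa using hlt⟩
      by_cases hj : j = i
      · subst hj; simpa using hlt.le
      · simp [hj]
    linarith
  · have key : ∀ s : ℝ, |s| = 1 → s * (∑ x, μ x * boolSign (x i) - ∑ x, ν x * boolSign (x i))
        ≤ 2 * ρ i := by
      intro s hs
      have := hρ (fun x => s * boolSign (x i)) (Pi.single i 2) (by
        intro j x c
        by_cases hj : j = i
        · subst hj
          rw [← mul_sub, abs_mul, hs, one_mul]
          simp only [Function.update_self, Pi.single_eq_same, boolSign]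
          split_ifs <;> norm_num
        · simp [hj, Ne.symm hj])
      simp only [Pi.single_apply, mul_ite, mul_zero, Finset.sum_ite_eq', Finset.mem_univ,
        if_true] at this
      calc _ = ∑ x, μ x * (s * boolSign (x i)) - ∑ x, ν x * (s * boolSign (x i)) := by
            rw [mul_sub, Finset.mul_sum, Finset.mul_sum]
            congr 1 <;> exact Finset.sum_congr rfl fun x _ => by ring
        _ ≤ _ := by linarith
    have k1 := key 1 (by simp)
    have k2 := key (-1) (by simp)
    exact abs_le.2 ⟨by linarith, by linarith⟩

end Dobrushin

section Induction

lemma nonneg_of_supersolution {ι : Type*} [Fintype ι] {A : ι → ι → ℝ} (hA : ∀ i j, 0 ≤ A i j)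
    (hrow : ∀ i, ∑ j, A i j ≤ 1) {r : ι → ℝ} (hr : ∀ i, 1 + ∑ j, A i j * r j ≤ r i) (i : ι) :
    0 ≤ r i := by
  have : Nonempty ι := ⟨i⟩
  obtain ⟨k, hk⟩ := Finite.exists_min r
  refine le_trans ?_ (hk i)
  by_contra! hneg
  have h1 : (∑ j, A k j) * r k ≤ ∑ j, A k j * r j := by
    rw [Finset.sum_mul]
    exact Finset.sum_le_sum fun j _ => mul_le_mul_of_nonneg_left (hk j) (hA k j)
  nlinarith [hrow k, hr k]

lemma sum_le_of_subsolution {ι : Type*} [Fintype ι] {A : ι → ι → ℝ}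
    (hsymm : ∀ i j, A i j = A j i) {r ρ b : ι → ℝ} (hr0 : ∀ i, 0 ≤ r i)
    (hr : ∀ i, 1 + ∑ j, A i j * r j ≤ r i) (hρ0 : ∀ i, 0 ≤ ρ i)
    (hρ : ∀ i, ρ i ≤ ∑ j, A i j * ρ j + b i) : ∑ i, ρ i ≤ ∑ i, b i * r i := by
  have hswap : ∑ i, ρ i * ∑ j, A i j * r j = ∑ i, r i * ∑ j, A i j * ρ j := by
    simp_rw [Finset.mul_sum]
    rw [Finset.sum_comm]
    refine Finset.sum_congr rfl fun i _ => Finset.sum_congr rfl fun j _ => ?_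
    rw [hsymm j i]
    ring
  have h1 : ∑ i, (ρ i + ρ i * ∑ j, A i j * r j) ≤ ∑ i, ρ i * r i :=
    Finset.sum_le_sum fun i _ => by nlinarith [hr i, hρ0 i]
  have h2 : ∑ i, ρ i * r i ≤ ∑ i, (r i * ∑ j, A i j * ρ j + b i * r i) :=
    Finset.sum_le_sum fun i _ => by nlinarith [hρ i, hr0 i]
  rw [Finset.sum_add_distrib] at h1 h2
  linarith

/-- The mean of the `i`-th sign under the unnormalised weights `q`. -/
def signMean {ι : Type*} [Fintype ι] [DecidableEq ι] (q : (ι → Bool) → ℝ) (i : ι) : ℝ :=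
  (∑ x, q x * boolSign (x i)) / ∑ x, q x

lemma sum_bool_cons {n : ℕ} (F : (Fin (n + 1) → Bool) → ℝ) :
    ∑ x, F x = ∑ x : Fin n → Bool, F (Fin.cons true x) +
      ∑ x : Fin n → Bool, F (Fin.cons false x) := by
  rw [← (Fin.consEquiv fun _ : Fin (n + 1) => Bool).sum_comp, Fintype.sum_prod_type,
    Fintype.sum_bool]
  rfl

lemma condProb_cons {n : ℕ} (q : (Fin (n + 1) → Bool) → ℝ) (e : Bool) (i : Fin n)
    (x : Fin n → Bool) :
    condProb (fun y => q (Fin.cons e y)) i x = condProb q i.succ (Fin.cons e x) := by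
  simp only [condProb, Fin.cons_update]

lemma condProb_div_const {ι : Type*} [DecidableEq ι] (q : (ι → Bool) → ℝ) {Q : ℝ} (hQ : Q ≠ 0) :
    condProb (fun y => q y / Q) = condProb q := by
  ext i x
  simp only [condProb]
  rw [← add_div, div_div_div_cancel_right₀ hQ]

/-- The embedding of `ℝⁿ` in `ℝⁿ⁺¹` with vanishing first coordinate. -/
def consZeroCLM (n : ℕ) : (Fin n → ℝ) →L[ℝ] (Fin (n + 1) → ℝ) :=
  ContinuousLinearMap.pi fun j => Fin.cases 0 (fun i => ContinuousLinearMap.proj i) j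

lemma consZeroCLM_zero {n : ℕ} (y : Fin n → ℝ) : consZeroCLM n y 0 = 0 := rfl

lemma consZeroCLM_succ {n : ℕ} (y : Fin n → ℝ) (i : Fin n) : consZeroCLM n y i.succ = y i := rfl

lemma diagGaussian_map_consZeroCLM {n : ℕ} {r : Fin n → ℝ} (hr : ∀ i, 0 ≤ r i) :
    (diagGaussian r).map (consZeroCLM n) = diagGaussian (consZeroCLM n r) := by
  refine map_diagGaussian hr (fun i => ?_) _ fun l => ?_
  · cases i using Fin.cases with
    | zero => exact le_rfl
    | succ i => exact hr i
  · simp [Fin.sum_univ_succ, consZeroCLM_zero, consZeroCLM_succ, Pi.single_apply]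

/-- The increment of the mean of a sign vector when its first coordinate is revealed. -/
lemma signMean_cons {n : ℕ} {q : (Fin (n + 1) → Bool) → ℝ} (hq : ∀ x, 0 < q x) (i : Fin n)
    (e : Bool) :
    signMean (fun y => q (Fin.cons e y)) i - signMean q i.succ = (boolSign e - signMean q 0) *
      ((signMean (fun y => q (Fin.cons true y)) i -
        signMean (fun y => q (Fin.cons false y)) i) / 2) := by
  have h1 : 0 < ∑ y : Fin n → Bool, q (Fin.cons true y) :=
    Finset.sum_pos (fun y _ => hq _) Finset.univ_nonempty
  have h0 : 0 < ∑ y : Fin n → Bool, q (Fin.cons false y) :=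
    Finset.sum_pos (fun y _ => hq _) Finset.univ_nonempty
  simp only [signMean, sum_bool_cons, Fin.cons_zero, Fin.cons_succ]
  rw [← Finset.sum_mul, ← Finset.sum_mul]
  cases e <;>
  · generalize ∑ y : Fin n → Bool, q (Fin.cons true y) = Q1 at *
    generalize ∑ y : Fin n → Bool, q (Fin.cons false y) = Q0 at *
    generalize ∑ y : Fin n → Bool, q (Fin.cons true y) * boolSign (y i) = P1
    generalize ∑ y : Fin n → Bool, q (Fin.cons false y) * boolSign (y i) = P0
    have h10 : Q1 + Q0 ≠ 0 := by positivity
    simp only [boolSign, if_true, if_false, Bool.false_eq_true]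
    field_simp
    ring

lemma abs_boolSign_sub_signMean_le {ι : Type*} [Fintype ι] [DecidableEq ι] {q : (ι → Bool) → ℝ}
    (hq : ∀ x, 0 < q x) (i : ι) (e : Bool) : |boolSign e - signMean q i| ≤ 2 := by
  have hQ : 0 < ∑ x, q x := Finset.sum_pos (fun y _ => hq _) Finset.univ_nonempty
  have hs : ∀ e, |boolSign e| ≤ 1 := fun e => by cases e <;> simp [boolSign]
  have h1 : |signMean q i| ≤ 1 := by
    rw [signMean, abs_div, abs_of_pos hQ, div_le_one hQ]
    refine (Finset.abs_sum_le_sum_abs _ _).trans (Finset.sum_le_sum fun x _ => ?_)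
    rw [abs_mul, abs_of_pos (hq x)]
    exact mul_le_of_le_one_right (hq x).le (hs _)
  exact (abs_sub _ _).trans (by linarith [hs e])

/-- Two-point analogue: a centred law on `{t₁, t₀} ⊆ [-2, 2]` is dominated by a uniform sign. -/
lemma ConvexLipschitz.centred_two_point_le {E : Type*} [NormedAddCommGroup E] [NormedSpace ℝ E]
    {f : E → ℝ} (hf : ConvexLipschitz f) (v : E) {p₁ p₀ t₁ t₀ : ℝ} (hp₁ : 0 ≤ p₁) (hp₀ : 0 ≤ p₀)
    (h₁ : |t₁| ≤ 2) (h₀ : |t₀| ≤ 2) (hmean : p₁ * t₁ + p₀ * t₀ = 0) :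
    p₁ * f (t₁ • v) + p₀ * f (t₀ • v)
      ≤ (p₁ + p₀) * ((f ((2 : ℝ) • v) + f (-(2 : ℝ) • v)) / 2) := by
  have c₁ := mul_le_mul_of_nonneg_left (hf.chord_le v two_pos h₁) hp₁
  have c₀ := mul_le_mul_of_nonneg_left (hf.chord_le v two_pos h₀) hp₀
  linear_combination c₁ + c₀ + (f ((2 : ℝ) • v) - f (-(2 : ℝ) • v)) / 4 * hmean

/-- A sign vector whose conditional laws have influences bounded by a symmetric substochastic
matrix `A` is dominated, once centred, by a diagonal Gaussian, against convex functions. -/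
theorem sum_sign_le_integral_diagGaussian (n : ℕ) : ∀ (q : (Fin n → Bool) → ℝ)
    (A : Fin n → Fin n → ℝ) (r : Fin n → ℝ), (∀ x, 0 < q x) → (∀ i j, 0 ≤ A i j) →
    (∀ i j, A i j = A j i) → (∀ i, ∑ j, A i j ≤ 1) →
    (∀ i j, i ≠ j → ∀ x c, |condProb q i (Function.update x j c) - condProb q i x| ≤ A i j) →
    (∀ i, 1 + ∑ j, A i j * r j ≤ r i) →
    ∀ f : (Fin n → ℝ) → ℝ, ConvexLipschitz f →
      ∑ x, q x * f (fun i => boolSign (x i) - signMean q i)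
        ≤ (∑ x, q x) * ∫ y, f y ∂diagGaussian ((2 / gaussianAbsMoment) ^ 2 • r) := by
  induction n with
  | zero =>
    intro q A r _ _ _ _ _ _ f _
    have h : ∀ y, f y = f 0 := fun y => by rw [Subsingleton.elim y 0]
    simp [h]
  | succ n ih =>
    intro q A r hq hA hsymm hrow hinf hr f hf
    set c2 := (2 / gaussianAbsMoment) ^ 2 with hc2def
    have hc2 : 0 ≤ c2 := sq_nonneg _
    set qe : Bool → (Fin n → Bool) → ℝ := fun e y => q (Fin.cons e y) with hqe
    have hqe0 : ∀ e x, 0 < qe e x := fun e x => hq _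
    have hQ : ∀ e, 0 < ∑ x, qe e x := fun e =>
      Finset.sum_pos (fun y _ => hqe0 e y) Finset.univ_nonempty
    have hrnn := nonneg_of_supersolution hA hrow hr
    have hinf' : ∀ e i j, i ≠ j → ∀ x c,
        |condProb (qe e) i (Function.update x j c) - condProb (qe e) i x| ≤ A i.succ j.succ := by
      intro e i j hij x c
      rw [hqe, condProb_cons, condProb_cons, Fin.cons_update]
      exact hinf _ _ (fun h => hij (Fin.succ_injective _ h)) _ _
    have hdiv : ∀ e, condProb (fun y => qe e y / ∑ x, qe e x) = condProb (qe e) := fun e =>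
      condProb_div_const _ (hQ e).ne'
    obtain ⟨ρ, hρ0, hρ, hmean⟩ := exists_subsolution_mean_sub_le
      (μ := fun y => qe true y / ∑ x, qe true x) (ν := fun y => qe false y / ∑ x, qe false x)
      (A := fun i j => A i.succ j.succ) (b := fun i => A i.succ 0)
      (fun x => div_pos (hqe0 _ x) (hQ _)) (fun x => div_pos (hqe0 _ x) (hQ _))
      (by rw [← Finset.sum_div, div_self (hQ _).ne'])
      (by rw [← Finset.sum_div, div_self (hQ _).ne'])
      (fun i j => hA _ _) (fun i => hA _ _)
      (by rw [hdiv]; exact hinf' true)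
      (by
        intro i x
        rw [hdiv, hdiv, hqe, condProb_cons, condProb_cons]
        have := hinf i.succ 0 (Fin.succ_ne_zero i) (Fin.cons false x) true
        rwa [Fin.update_cons_zero] at this)
    have hmean' : ∀ i, |signMean (qe true) i - signMean (qe false) i| ≤ 2 * ρ i := fun i => by
      have := hmean i
      simp only [div_mul_eq_mul_div] at this
      rwa [← Finset.sum_div, ← Finset.sum_div] at this
    set r' : Fin n → ℝ := fun i => r i.succ - ρ i * r 0 with hr'def
    have hr' : ∀ i, 1 + ∑ j : Fin n, A i.succ j.succ * r' j ≤ r' i := by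
      intro i
      have h1 := hr i.succ
      rw [Fin.sum_univ_succ] at h1
      have h2 := mul_le_mul_of_nonneg_right (hρ i) (hrnn 0)
      have h3 : ∑ j : Fin n, A i.succ j.succ * r' j = ∑ j : Fin n, A i.succ j.succ * r j.succ
          - (∑ j : Fin n, A i.succ j.succ * ρ j) * r 0 := by
        rw [Finset.sum_mul, ← Finset.sum_sub_distrib]
        exact Finset.sum_congr rfl fun j _ => by rw [hr'def]; ring
      rw [h3]
      simp only [hr'def]
      linarith
    have hrow' : ∀ i : Fin n, ∑ j : Fin n, A i.succ j.succ ≤ 1 := fun i => by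
      have := hrow i.succ
      rw [Fin.sum_univ_succ] at this
      linarith [hA i.succ 0]
    have hr'nn := nonneg_of_supersolution (A := fun i j : Fin n => A i.succ j.succ)
      (fun i j => hA _ _) hrow' hr'
    have hρsum : 1 + ∑ i, ρ i ≤ r 0 := by
      have h1 := sum_le_of_subsolution (A := fun i j : Fin n => A i.succ j.succ)
        (fun i j => hsymm _ _) hr'nn hr' hρ0 hρ
      have h2 := hr 0
      rw [Fin.sum_univ_succ] at h2
      have h3 : ∑ i : Fin n, A i.succ 0 * r' i ≤ ∑ i : Fin n, A 0 i.succ * r i.succ := by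
        refine Finset.sum_le_sum fun i _ => ?_
        rw [hsymm]
        refine mul_le_mul_of_nonneg_left ?_ (hA _ _)
        linarith [mul_nonneg (hρ0 i) (hrnn 0)]
      linarith [mul_nonneg (hA 0 0) (hrnn 0)]
    have hr0 : 0 < r 0 := by linarith [Finset.sum_nonneg fun i (_ : i ∈ Finset.univ) => hρ0 i]
    set v : Fin (n + 1) → ℝ :=
      Fin.cons 1 fun i => (signMean (qe true) i - signMean (qe false) i) / 2 with hv
    set s : Fin (n + 1) → ℝ := Fin.cons (r 0) fun i => ρ i * r 0 with hs
    have hsnn : ∀ i, 0 ≤ s i := by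
      intro i
      cases i using Fin.cases with
      | zero => exact hr0.le
      | succ i => exact mul_nonneg (hρ0 i) hr0.le
    have hcs : ∀ i, 0 ≤ (c2 • s) i := fun i => mul_nonneg hc2 (hsnn i)
    have hvρ : ∀ i, |(signMean (qe true) i - signMean (qe false) i) / 2| ≤ ρ i := fun i => by
      rw [abs_div, abs_two, div_le_iff₀ two_pos, mul_comm]
      exact hmean' i
    have hvs : ∀ i, s i = 0 → v i = 0 := by
      intro i
      cases i using Fin.cases with
      | zero => intro h; exact absurd h hr0.ne'
      | succ i =>
        intro h
        have : ρ i = 0 := (mul_eq_zero.1 h).resolve_right hr0.ne'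
        have h2 := hvρ i
        rw [this] at h2
        exact abs_nonpos_iff.1 h2
    have hqv : ∑ i, v i ^ 2 / s i
        = 1 / r 0 + ∑ i, ((signMean (qe true) i - signMean (qe false) i) / 2) ^ 2 / (ρ i * r 0) := by
      rw [Fin.sum_univ_succ]
      simp [hv, hs]
    have hqpos : 0 < ∑ i, v i ^ 2 / s i := by
      rw [hqv]
      exact add_pos_of_pos_of_nonneg (by positivity)
        (Finset.sum_nonneg fun i _ => div_nonneg (sq_nonneg _) (mul_nonneg (hρ0 i) hr0.le))
    have hq1 : ∑ i, v i ^ 2 / s i ≤ 1 := by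
      rw [hqv]
      calc _ ≤ 1 / r 0 + ∑ i, ρ i / r 0 := by
            refine add_le_add le_rfl (Finset.sum_le_sum fun i _ => ?_)
            refine div_le_of_le_mul₀ (mul_nonneg (hρ0 i) hr0.le) (div_nonneg (hρ0 i) hr0.le) ?_
            rw [show ρ i / r 0 * (ρ i * r 0) = ρ i ^ 2 by field_simp]
            exact sq_le_sq' (abs_le.1 (hvρ i)).1 (abs_le.1 (hvρ i)).2
        _ = (1 + ∑ i, ρ i) / r 0 := by rw [← Finset.sum_div, add_div]
        _ ≤ 1 := by rwa [div_le_one hr0]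
    set z' := consZeroCLM n r' with hz'
    have hz'nn : ∀ i, 0 ≤ (c2 • z') i := by
      intro i
      cases i using Fin.cases with
      | zero => simp [hz', consZeroCLM_zero]
      | succ i => simpa [hz', consZeroCLM_succ] using mul_nonneg hc2 (hr'nn i)
    have hsz : c2 • z' + c2 • s = c2 • r := by
      ext i
      cases i using Fin.cases with
      | zero => simp [hz', consZeroCLM_zero, hs]
      | succ i =>
        simp only [hz', hs, Pi.add_apply, Pi.smul_apply, smul_eq_mul, consZeroCLM_succ,
          Fin.cons_succ, hr'def]
        ring
    set t : Bool → ℝ := fun e => boolSign e - signMean q 0 with ht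
    set μ := diagGaussian (c2 • z') with hμ
    have hμid : Integrable id μ := integrable_id_diagGaussian _
    have hstep : ∀ e, ∑ x, qe e x * f (fun i => boolSign ((Fin.cons e x : Fin (n + 1) → Bool) i)
          - signMean q i) ≤ (∑ x, qe e x) * ∫ z, f (z + t e • v) ∂μ := by
      intro e
      have hfe := hf.comp_add_const (t e • v)
      have := ih (qe e) (fun i j => A i.succ j.succ) r' (hqe0 e) (fun i j => hA _ _)
        (fun i j => hsymm _ _) hrow' (hinf' e) hr' _ (hfe.comp_clm (consZeroCLM n))
      have hmap : ∫ z, f (z + t e • v) ∂μ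
          = ∫ y, f (consZeroCLM n y + t e • v) ∂diagGaussian (c2 • r') := by
        rw [hμ, hz', ← map_smul, ← diagGaussian_map_consZeroCLM
          (r := c2 • r') (fun i => mul_nonneg hc2 (hr'nn i)), integral_map (by fun_prop)
          hfe.continuous.aestronglyMeasurable]
      rw [hmap]
      refine le_of_eq_of_le (Finset.sum_congr rfl fun x _ => ?_) this
      congr 2
      ext i
      cases i using Fin.cases with
      | zero => simp [consZeroCLM_zero, ht, hv]
      | succ i =>
        have := signMean_cons hq i e
        simp only [Fin.cons_succ, Pi.add_apply, consZeroCLM_succ, Pi.smul_apply, smul_eq_mul,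
          ht, hv]
        rw [← this]
        ring
    have htm : (∑ x, qe true x) * t true + (∑ x, qe false x) * t false = 0 := by
      have h1 := hQ true
      have h0 := hQ false
      simp only [ht, signMean, sum_bool_cons, Fin.cons_zero]
      rw [← Finset.sum_mul, ← Finset.sum_mul]
      simp only [hqe] at h1 h0 ⊢
      simp only [boolSign]
      field_simp
      norm_num
      ring
    have hfint : ∀ w, Integrable (fun z => f (z + w)) μ := fun w =>
      (hf.comp_add_const w).integrable hμid
    have hconvint : Integrable f (μ ∗ diagGaussian (c2 • s)) := by
      rw [hμ, diagGaussian_conv (s := c2 • s) hz'nn hcs]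
      exact hf.integrable (integrable_id_diagGaussian _)
    have hprod : Integrable (fun z => ∫ y, f (z + y) ∂diagGaussian (c2 • s)) μ := by
      have h1 : Integrable (f ∘ fun p : (Fin (n + 1) → ℝ) × (Fin (n + 1) → ℝ) => p.1 + p.2)
          (μ.prod (diagGaussian (c2 • s))) :=
        (integrable_map_measure hf.continuous.aestronglyMeasurable (by fun_prop)).1 hconvint
      exact h1.integral_prod_left
    rw [sum_bool_cons (fun x => q x * f (fun i => boolSign (x i) - signMean q i)), sum_bool_cons q]
    calc _ ≤ (∑ x, qe true x) * ∫ z, f (z + t true • v) ∂μ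
          + (∑ x, qe false x) * ∫ z, f (z + t false • v) ∂μ :=
        add_le_add (hstep true) (hstep false)
      _ = ∫ z, ((∑ x, qe true x) * f (z + t true • v)
          + (∑ x, qe false x) * f (z + t false • v)) ∂μ := by
        rw [integral_add ((hfint _).const_mul _) ((hfint _).const_mul _), integral_const_mul,
          integral_const_mul]
      _ ≤ ∫ z, ((∑ x, qe true x) + ∑ x, qe false x) *
          ∫ y, f (z + y) ∂diagGaussian (c2 • s) ∂μ := by
        refine integral_mono (((hfint _).const_mul _).add ((hfint _).const_mul _))
          (hprod.const_mul _) fun z => ?_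
        have hfz : ConvexLipschitz fun y => f (z + y) := by
          simpa [add_comm] using hf.comp_add_const z
        refine (hfz.centred_two_point_le v (hQ true).le (hQ false).le
          (abs_boolSign_sub_signMean_le hq 0 true) (abs_boolSign_sub_signMean_le hq 0 false)
          htm).trans ?_
        exact mul_le_mul_of_nonneg_left (hfz.two_point_le_diagGaussian hsnn hvs hqpos hq1)
          (add_nonneg (hQ true).le (hQ false).le)
      _ = _ := by
        rw [integral_const_mul, ← integral_conv hconvint, hμ,
          diagGaussian_conv (s := c2 • s) hz'nn hcs, hsz]

end Induction

section LogInfluence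

lemma abs_sigmoid_sub_le (x y : ℝ) : |Real.sigmoid x - Real.sigmoid y| ≤ |x - y| / 4 := by
  have h := Convex.norm_image_sub_le_of_norm_deriv_le (f := Real.sigmoid) (C := 1 / 4)
    (s := Set.univ) (x := y) (y := x) (fun t _ => differentiable_sigmoid t) (fun t _ => ?_)
    convex_univ (Set.mem_univ _) (Set.mem_univ _)
  · simp only [Real.norm_eq_abs] at h
    linarith
  · rw [Real.deriv_sigmoid, Real.norm_eq_abs]
    refine abs_le.2 ⟨?_, ?_⟩ <;>
      nlinarith [sq_nonneg (Real.sigmoid t - 1 / 2), Real.sigmoid_pos t, Real.sigmoid_lt_one t]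

lemma sigmoid_log_sub_log {a b : ℝ} (ha : 0 < a) (hb : 0 < b) :
    Real.sigmoid (Real.log a - Real.log b) = a / (a + b) := by
  rw [Real.sigmoid_def, neg_sub, Real.exp_sub, Real.exp_log ha, Real.exp_log hb]
  field_simp

lemma updTwo_comm {Z : Type*} {m : ℕ} {i j : Fin m} (hij : i ≠ j) (z : Fin m → Z) (a b : Z) :
    updTwo z i a j b = updTwo z j b i a :=
  by unfold updTwo; exact Function.update_comm hij a b z

/-- The configuration following `s` where `ε` is true and `s'` elsewhere. -/
def mix {ι Z : Type*} (ε : ι → Bool) (s s' : ι → Z) : ι → Z := fun i => if ε i then s i else s' i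

lemma mix_update {Z : Type*} {m : ℕ} (ε : Fin m → Bool) (s s' : Fin m → Z) (i : Fin m) (b : Bool) :
    mix (Function.update ε i b) s s' = Function.update (mix ε s s') i (if b then s i else s' i) := by
  ext k
  by_cases hk : k = i
  · subst hk; simp [mix]
  · simp [mix, hk]

lemma mix_not {ι : Type*} (ε : ι → Bool) (s s' : ι → Z) : mix (fun i => !ε i) s s' = mix ε s' s := by
  ext i
  cases h : ε i <;> simp [mix, h]

/-- The unnormalised weights of the signs which, applied to the coordinatewise swaps of a pair
`(s, s')` of independent samples, generate the conditional law of the pair. -/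
def swapWeight {Z : Type*} {m : ℕ} (p : (Fin m → Z) → ℝ) (s s' : Fin m → Z)
    (ε : Fin m → Bool) : ℝ :=
  p (mix ε s s') * p (mix ε s' s)

lemma swapWeight_pos {Z : Type*} {m : ℕ} {p : (Fin m → Z) → ℝ} (hp : ∀ z, 0 < p z) (s s' : Fin m → Z)
    (ε : Fin m → Bool) : 0 < swapWeight p s s' ε := mul_pos (hp _) (hp _)

lemma signMean_swapWeight {Z : Type*} {m : ℕ} (p : (Fin m → Z) → ℝ) (s s' : Fin m → Z) (i : Fin m) :
    signMean (swapWeight p s s') i = 0 := by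
  have hinv : Function.Involutive fun (x : Fin m → Bool) k => !x k := fun x => by simp
  have h := Equiv.sum_comp hinv.toPerm fun x => swapWeight p s s' x * boolSign (x i)
  have hb : ∀ b, boolSign (!b) = -boolSign b := fun b => by cases b <;> simp [boolSign]
  simp only [Function.Involutive.coe_toPerm, hb, swapWeight, mix_not, mul_neg,
    Finset.sum_neg_distrib] at h
  simp only [mul_comm (p (mix _ s' s))] at h
  rw [signMean, div_eq_zero_iff]
  left
  simp only [swapWeight]
  linarith

variable {Z : Type*} [Fintype Z] {m : ℕ} {p : (Fin m → Z) → ℝ}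

lemma log_ratio_le_four_mul_logInfluence (p : (Fin m → Z) → ℝ) (i j : Fin m) (z : Fin m → Z)
    (a b a' b' : Z) :
    Real.log (p (updTwo z i a j b) * p (updTwo z i a' j b') /
      (p (updTwo z i a' j b) * p (updTwo z i a j b'))) ≤ 4 * logInfluence p i j := by
  have h := le_ciSup (Set.finite_range fun w : (Fin m → Z) × Z × Z × Z × Z =>
    Real.log (p (updTwo w.1 i w.2.1 j w.2.2.1) * p (updTwo w.1 i w.2.2.2.1 j w.2.2.2.2) /
      (p (updTwo w.1 i w.2.2.2.1 j w.2.2.1) * p (updTwo w.1 i w.2.1 j w.2.2.2.2)))).bddAbove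
    (z, a, b, a', b')
  rw [logInfluence]
  dsimp only at h
  linarith

lemma logInfluence_nonneg [Nonempty Z] (hp : ∀ z, 0 < p z) (i j : Fin m) :
    0 ≤ logInfluence p i j := by
  obtain ⟨a⟩ := ‹Nonempty Z›
  have h := log_ratio_le_four_mul_logInfluence p i j (fun _ => a) a a a a
  have h0 := hp (updTwo (fun _ => a) i a j a)
  rw [div_self (by positivity), Real.log_one] at h
  linarith

lemma logInfluence_le_swap [Nonempty Z] {i j : Fin m} (hij : i ≠ j) :
    logInfluence p i j ≤ logInfluence p j i := by
  have h : (⨆ w : (Fin m → Z) × Z × Z × Z × Z,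
    Real.log (p (updTwo w.1 i w.2.1 j w.2.2.1) * p (updTwo w.1 i w.2.2.2.1 j w.2.2.2.2) /
      (p (updTwo w.1 i w.2.2.2.1 j w.2.2.1) * p (updTwo w.1 i w.2.1 j w.2.2.2.2))))
      ≤ 4 * logInfluence p j i := by
    refine ciSup_le fun w => ?_
    refine le_of_eq_of_le ?_
      (log_ratio_le_four_mul_logInfluence p j i w.1 w.2.2.1 w.2.1 w.2.2.2.2 w.2.2.2.1)
    simp only [updTwo_comm hij]
    rw [mul_comm (p (updTwo w.1 j w.2.2.1 i w.2.2.2.1))]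
  rw [logInfluence]
  linarith

lemma logInfluence_comm [Nonempty Z] {i j : Fin m} (hij : i ≠ j) :
    logInfluence p i j = logInfluence p j i :=
  (logInfluence_le_swap hij).antisymm (logInfluence_le_swap hij.symm)

lemma sum_logInfluence_le_logCoefficient (p : (Fin m → Z) → ℝ) (i : Fin m) :
    ∑ j ∈ Finset.univ.erase i, logInfluence p i j ≤ logCoefficient p :=
  le_ciSup (f := fun i => ∑ j ∈ Finset.univ.erase i, logInfluence p i j)
    (Set.finite_range _).bddAbove i

lemma abs_log_mixed_difference_le (hp : ∀ z, 0 < p z) (i j : Fin m) (z : Fin m → Z)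
    (a b a' b' : Z) :
    |Real.log (p (updTwo z i a j b)) - Real.log (p (updTwo z i a' j b)) -
      (Real.log (p (updTwo z i a j b')) - Real.log (p (updTwo z i a' j b')))|
      ≤ 4 * logInfluence p i j := by
  have h1 := log_ratio_le_four_mul_logInfluence p i j z a b a' b'
  have h2 := log_ratio_le_four_mul_logInfluence p i j z a' b a b'
  have h : ∀ y, p y ≠ 0 := fun y => (hp y).ne'
  rw [Real.log_div (mul_ne_zero (h _) (h _)) (mul_ne_zero (h _) (h _)), Real.log_mul (h _) (h _),
    Real.log_mul (h _) (h _)] at h1 h2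
  exact abs_le.2 ⟨by linarith, by linarith⟩

lemma abs_log_mix_difference_le (hp : ∀ z, 0 < p z) {i j : Fin m} (hij : i ≠ j)
    (s s' : Fin m → Z) (x : Fin m → Bool) (b b' c : Bool) :
    |Real.log (p (mix (Function.update (Function.update x j c) i b) s s')) -
      Real.log (p (mix (Function.update (Function.update x j c) i b') s s')) -
      (Real.log (p (mix (Function.update x i b) s s')) -
        Real.log (p (mix (Function.update x i b') s s')))| ≤ 4 * logInfluence p i j := by
  have h := abs_log_mixed_difference_le hp i j (mix x s s') (if b then s i else s' i)
    (if c then s j else s' j) (if b' then s i else s' i) (if x j then s j else s' j)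
  simp only [updTwo_comm hij] at h
  simpa only [updTwo, ← mix_update, Function.update_eq_self] using h

lemma abs_condProb_swapWeight_sub_le (hp : ∀ z, 0 < p z) {i j : Fin m} (hij : i ≠ j)
    (s s' : Fin m → Z) (x : Fin m → Bool) (c : Bool) :
    |condProb (swapWeight p s s') i (Function.update x j c) - condProb (swapWeight p s s') i x|
      ≤ 2 * logInfluence p i j := by
  have hq := swapWeight_pos hp s s'
  rw [condProb, condProb, ← sigmoid_log_sub_log (hq _) (hq _), ← sigmoid_log_sub_log (hq _) (hq _)]
  refine (abs_sigmoid_sub_le _ _).trans ?_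
  have h1 := abs_le.1 (abs_log_mix_difference_le hp hij s s' x true false c)
  have h2 := abs_le.1 (abs_log_mix_difference_le hp hij s' s x true false c)
  have hlog : ∀ ε, Real.log (swapWeight p s s' ε)
      = Real.log (p (mix ε s s')) + Real.log (p (mix ε s' s)) := fun ε =>
    Real.log_mul (hp _).ne' (hp _).ne'
  rw [div_le_iff₀ (by norm_num), abs_le]
  simp only [hlog]
  exact ⟨by linarith [h1.1, h2.1], by linarith [h1.2, h2.2]⟩

theorem sum_swapWeight_le [Nonempty Z] (hp : ∀ z, 0 < p z) (hα : logCoefficient p < 1 / 2)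
    (s s' : Fin m → Z) {f : (Fin m → ℝ) → ℝ} (hf : ConvexLipschitz f) :
    ∑ ε, swapWeight p s s' ε * f (fun i => boolSign (ε i)) ≤ (∑ ε, swapWeight p s s' ε) *
      ∫ y, f y ∂diagGaussian
        ((2 / gaussianAbsMoment) ^ 2 • fun _ : Fin m => (1 - 2 * logCoefficient p)⁻¹) := by
  have hα' : 0 < 1 - 2 * logCoefficient p := by linarith
  have hrow : ∀ i : Fin m, ∑ j, (if i = j then 0 else 2 * logInfluence p i j)
      ≤ 2 * logCoefficient p := fun i => by
    have h := sum_logInfluence_le_logCoefficient p i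
    rw [← Finset.add_sum_erase _ _ (Finset.mem_univ i), if_pos rfl, zero_add,
      Finset.sum_congr rfl fun j hj => if_neg (Finset.ne_of_mem_erase hj).symm, ← Finset.mul_sum]
    linarith
  have h := sum_sign_le_integral_diagGaussian m (swapWeight p s s')
    (fun i j => if i = j then 0 else 2 * logInfluence p i j)
    (fun _ => (1 - 2 * logCoefficient p)⁻¹) (swapWeight_pos hp s s')
    (fun i j => by
      have := logInfluence_nonneg hp i j
      split_ifs <;> positivity)
    (fun i j => by
      by_cases hij : i = j
      · rw [hij]
      · rw [if_neg hij, if_neg (Ne.symm hij), logInfluence_comm hij])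
    (fun i => (hrow i).trans (by linarith))
    (fun i j hij x c => by
      rw [if_neg hij]
      exact abs_condProb_swapWeight_sub_le hp hij s s' x c)
    (fun i => by
      rw [← Finset.sum_mul]
      have := mul_le_mul_of_nonneg_right (hrow i) (inv_pos.2 hα').le
      have h1 : (1 - 2 * logCoefficient p) * (1 - 2 * logCoefficient p)⁻¹ = 1 :=
        mul_inv_cancel₀ hα'.ne'
      linarith) f hf
  simpa only [signMean_swapWeight, sub_zero] using h

end LogInfluence

section LinearSup

variable {ι : Type*} [Fintype ι]

/-- The supremum over `n` of the linear forms `x ↦ a ∑ᵢ xᵢ F n i`. -/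
def linearSup (a : ℝ) (F : ℕ → ι → ℝ) (x : ι → ℝ) : ℝ := ⨆ n, a * ∑ i, x i * F n i

lemma bddAbove_linearSup (a : ℝ) {F : ℕ → ι → ℝ} {K : ℝ} (hF : ∀ n i, |F n i| ≤ K) (x : ι → ℝ) :
    BddAbove (Set.range fun n => a * ∑ i, x i * F n i) := by
  refine ⟨|a| * ∑ i, |x i| * K, ?_⟩
  rintro _ ⟨n, rfl⟩
  refine (le_abs_self _).trans ?_
  rw [abs_mul]
  gcongr
  refine (Finset.abs_sum_le_sum_abs _ _).trans (Finset.sum_le_sum fun i _ => ?_)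
  rw [abs_mul]
  exact mul_le_mul_of_nonneg_left (hF n i) (abs_nonneg _)

lemma le_linearSup (a : ℝ) {F : ℕ → ι → ℝ} {K : ℝ} (hF : ∀ n i, |F n i| ≤ K) (x : ι → ℝ) (n : ℕ) :
    a * ∑ i, x i * F n i ≤ linearSup a F x :=
  le_ciSup (bddAbove_linearSup a hF x) n

lemma convexLipschitz_linearSup (a : ℝ) {F : ℕ → ι → ℝ} {K : ℝ} (hF : ∀ n i, |F n i| ≤ K) :
    ConvexLipschitz (linearSup a F) where
  convex := by
    refine ⟨convex_univ, fun x _ y _ b c hb hc _ => ciSup_le fun n => ?_⟩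
    have hx := mul_le_mul_of_nonneg_left (le_linearSup a hF x n) hb
    have hy := mul_le_mul_of_nonneg_left (le_linearSup a hF y n) hc
    refine le_of_eq_of_le ?_ (add_le_add hx hy)
    simp only [Pi.add_apply, Pi.smul_apply, smul_eq_mul, add_mul, Finset.sum_add_distrib,
      Finset.mul_sum, mul_add]
    congr 1 <;> exact Finset.sum_congr rfl fun i _ => by ring
  lipschitz := by
    refine ⟨(|a| * ∑ _i : ι, K).toNNReal, LipschitzWith.of_le_add_mul _
      fun x y => ciSup_le fun n => ?_⟩
    have h1 := le_linearSup a hF y n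
    have h2 : a * ∑ i, (x i - y i) * F n i ≤ (|a| * ∑ _i : ι, K) * dist x y := by
      refine (le_abs_self _).trans ?_
      rw [abs_mul, mul_assoc, Finset.sum_mul]
      refine mul_le_mul_of_nonneg_left ?_ (abs_nonneg _)
      refine (Finset.abs_sum_le_sum_abs _ _).trans (Finset.sum_le_sum fun i _ => ?_)
      rw [abs_mul, mul_comm]
      exact mul_le_mul (hF n i) (dist_le_pi_dist x y i) (abs_nonneg _)
        ((abs_nonneg _).trans (hF n i))
    have h3 := mul_le_mul_of_nonneg_right (Real.le_coe_toNNReal (|a| * ∑ _i : ι, K))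
      (dist_nonneg (x := x) (y := y))
    have h4 : a * ∑ i, x i * F n i = a * ∑ i, y i * F n i + a * ∑ i, (x i - y i) * F n i := by
      rw [← mul_add, ← Finset.sum_add_distrib]
      congr 1
      exact Finset.sum_congr rfl fun i _ => by ring
    linarith

lemma linearSup_smul (a : ℝ) (F : ℕ → ι → ℝ) {c : ℝ} (hc : 0 ≤ c) (x : ι → ℝ) :
    linearSup a F (fun i => c * x i) = c * linearSup a F x := by
  rw [linearSup, linearSup, Real.mul_iSup_of_nonneg hc]
  simp only [mul_assoc, ← Finset.mul_sum, mul_left_comm c a]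

lemma linearSup_mul (a : ℝ) (F : ℕ → ι → ℝ) (d x : ι → ℝ) :
    linearSup a (fun n i => d i * F n i) x = linearSup a F (fun i => d i * x i) := by
  simp only [linearSup]
  congr 1
  ext n
  congr 1
  exact Finset.sum_congr rfl fun i _ => by ring

lemma linearSup_sub_le (a : ℝ) {F F' : ℕ → ι → ℝ} {K : ℝ} (hF : ∀ n i, |F n i| ≤ K)
    (hF' : ∀ n i, |F' n i| ≤ K) (x : ι → ℝ) :
    linearSup a (fun n i => F n i - F' n i) x
      ≤ linearSup a F x + linearSup a F' (fun i => -1 * x i) := by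
  refine ciSup_le fun n => ?_
  refine le_of_eq_of_le ?_ (add_le_add (le_linearSup a hF x n) (le_linearSup a hF' _ n))
  rw [← mul_add, ← Finset.sum_add_distrib]
  congr 1
  exact Finset.sum_congr rfl fun i _ => by ring

lemma integral_diagGaussian_mul {r : ι → ℝ} (hr : ∀ i, 0 ≤ r i) (d : ι → ℝ) {f : (ι → ℝ) → ℝ}
    (hf : ConvexLipschitz f) :
    ∫ y, f (fun i => d i * y i) ∂diagGaussian r = ∫ y, f y ∂diagGaussian fun i => d i ^ 2 * r i := by
  have h := map_diagGaussian (s := fun i => d i ^ 2 * r i) hr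
    (fun i => mul_nonneg (sq_nonneg _) (hr i))
    (ContinuousLinearMap.pi fun i => d i • ContinuousLinearMap.proj i) fun l => by
      simp only [ContinuousLinearMap.coe_pi', smul_apply,
        ContinuousLinearMap.proj_apply, Pi.single_apply, smul_eq_mul, mul_ite, mul_one, mul_zero,
        Finset.sum_ite_eq', Finset.mem_univ, if_true]
      exact Finset.sum_congr rfl fun i _ => by ring
  rw [← h, integral_map (by fun_prop) hf.continuous.aestronglyMeasurable]
  rfl

lemma integral_linearSup_diagGaussian_const (a : ℝ) {F : ℕ → ι → ℝ} {K : ℝ}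
    (hF : ∀ n i, |F n i| ≤ K) {c : ℝ} (hc : 0 ≤ c) :
    ∫ y, linearSup a F y ∂diagGaussian (fun _ : ι => c ^ 2)
      = c * ∫ y, linearSup a F y ∂diagGaussian (1 : ι → ℝ) := by
  have h := integral_diagGaussian_mul (r := (1 : ι → ℝ)) (fun _ => zero_le_one) (fun _ => c)
    (convexLipschitz_linearSup a hF)
  simp only [linearSup_smul a F hc, integral_const_mul, Pi.one_apply, mul_one] at h
  exact h.symm

lemma integral_linearSup_mul_sign (a : ℝ) {F : ℕ → ι → ℝ} {K : ℝ} (hF : ∀ n i, |F n i| ≤ K)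
    {d : ι → ℝ} (hd : ∀ i, d i ^ 2 = 1) :
    ∫ y, linearSup a (fun n i => d i * F n i) y ∂diagGaussian (1 : ι → ℝ)
      = ∫ y, linearSup a F y ∂diagGaussian (1 : ι → ℝ) := by
  simp only [linearSup_mul]
  rw [integral_diagGaussian_mul (r := 1) (fun _ => zero_le_one) d (convexLipschitz_linearSup a hF)]
  simp only [hd, Pi.one_apply, mul_one]
  rfl

lemma integral_linearSup_sub_le (a : ℝ) {F F' : ℕ → ι → ℝ} {K : ℝ} (hF : ∀ n i, |F n i| ≤ K)
    (hF' : ∀ n i, |F' n i| ≤ K) :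
    ∫ y, linearSup a (fun n i => F n i - F' n i) y ∂diagGaussian (1 : ι → ℝ)
      ≤ ∫ y, linearSup a F y ∂diagGaussian (1 : ι → ℝ)
        + ∫ y, linearSup a F' y ∂diagGaussian (1 : ι → ℝ) := by
  have hid := integrable_id_diagGaussian (1 : ι → ℝ)
  have h2K : ∀ n i, |F n i - F' n i| ≤ K + K := fun n i =>
    (abs_sub _ _).trans (add_le_add (hF n i) (hF' n i))
  have hneg : ∀ n i, |-1 * F' n i| ≤ K := fun n i => by simpa using hF' n i
  have i1 := (convexLipschitz_linearSup a hF).integrable hid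
  have i2 := (convexLipschitz_linearSup a hneg).integrable hid
  rw [← integral_linearSup_mul_sign a hF' (d := fun _ => -1) (fun _ => by norm_num),
    ← integral_add i1 i2]
  refine integral_mono ((convexLipschitz_linearSup a h2K).integrable hid) (i1.add i2) fun x => ?_
  simp only [linearSup_mul]
  exact linearSup_sub_le a hF hF' x

end LinearSup

section Symmetrization

lemma sum_sum_mix {ι Z : Type*} [Fintype ι] [DecidableEq ι] [Fintype Z] (ε : ι → Bool)
    (Ψ : (ι → Z) → (ι → Z) → ℝ) :
    ∑ s, ∑ s', Ψ (mix ε s s') (mix ε s' s) = ∑ s, ∑ s', Ψ s s' := by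
  have hinv : Function.Involutive
      fun w : (ι → Z) × (ι → Z) => (mix ε w.1 w.2, mix ε w.2 w.1) := fun w => by
    ext i <;> cases h : ε i <;> simp [mix, h]
  have h := Equiv.sum_comp hinv.toPerm fun w => Ψ w.1 w.2
  rwa [Fintype.sum_prod_type, Fintype.sum_prod_type] at h

lemma card_mul_sum_sum {Z : Type*} [Fintype Z] {m : ℕ} (p : (Fin m → Z) → ℝ)
    (Ψ : (Fin m → Z) → (Fin m → Z) → ℝ) :
    (Fintype.card (Fin m → Bool) : ℝ) * ∑ s, ∑ s', p s * p s' * Ψ s s'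
      = ∑ s, ∑ s', ∑ ε, swapWeight p s s' ε * Ψ (mix ε s s') (mix ε s' s) := by
  have h : ∀ ε : Fin m → Bool, ∑ s, ∑ s', p s * p s' * Ψ s s'
      = ∑ s, ∑ s', swapWeight p s s' ε * Ψ (mix ε s s') (mix ε s' s) := fun ε =>
    (sum_sum_mix ε fun s s' => p s * p s' * Ψ s s').symm
  rw [← nsmul_eq_mul, ← Finset.card_univ, ← Finset.sum_const, Finset.sum_congr rfl fun ε _ => h ε,
    Finset.sum_comm]
  exact Finset.sum_congr rfl fun s _ => Finset.sum_comm

lemma sub_mix {ι Z : Type*} (g : Z → ℝ) (ε : ι → Bool) (s s' : ι → Z) (i : ι) :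
    g (mix ε s s' i) - g (mix ε s' s i) = boolSign (ε i) * (g (s i) - g (s' i)) := by
  cases h : ε i <;> simp [mix, h, boolSign]

variable {Z : Type*} [Fintype Z] {m : ℕ} {p : (Fin m → Z) → ℝ} {G : ℕ → Z → ℝ} {L : ℝ}

/-- Symmetrisation by an independent copy. -/
lemma sum_iSup_sub_le (hp : ∀ z, 0 < p z) (hp1 : ∑ z, p z = 1) (hG : ∀ n z, |G n z| ≤ L) :
    ∑ s, p s * ⨆ n : ℕ, ((m : ℝ)⁻¹ * ∑ i, G n (s i) -
        ∑ s', p s' * ((m : ℝ)⁻¹ * ∑ i, G n (s' i)))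
      ≤ ∑ s, ∑ s', p s * p s' *
        linearSup (m : ℝ)⁻¹ (fun n i => G n (s i) - G n (s' i)) fun _ => 1 := by
  refine Finset.sum_le_sum fun s _ => ?_
  simp only [mul_assoc, ← Finset.mul_sum]
  refine mul_le_mul_of_nonneg_left (ciSup_le fun n => ?_) (hp s).le
  calc _ = ∑ s', p s' * ((m : ℝ)⁻¹ * ∑ i, 1 * (G n (s i) - G n (s' i))) := by
        simp only [one_mul, Finset.sum_sub_distrib, mul_sub]
        rw [← Finset.sum_mul, hp1, one_mul]
    _ ≤ _ := Finset.sum_le_sum fun s' _ => mul_le_mul_of_nonneg_left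
        (le_linearSup (F := fun n i => G n (s i) - G n (s' i)) (K := L + L) _
          (fun n i => (abs_sub _ _).trans (add_le_add (hG _ _) (hG _ _))) (fun _ => 1) n) (hp s').le

lemma gaussianComplexity_eq (p : (Fin m → Z) → ℝ) (G : ℕ → Z → ℝ) :
    gaussianComplexity p G = ∑ s, p s *
      ∫ y, linearSup (m : ℝ)⁻¹ (fun n i => G n (s i)) y ∂diagGaussian (1 : Fin m → ℝ) := by
  simp only [gaussianComplexity, diagGaussian, Pi.one_apply, Real.toNNReal_one, linearSup]

lemma sum_sum_integral_le (hp : ∀ z, 0 < p z) (hp1 : ∑ z, p z = 1) (hG : ∀ n z, |G n z| ≤ L) :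
    ∑ s, ∑ s', p s * p s' * ∫ y, linearSup (m : ℝ)⁻¹ (fun n i => G n (s i) - G n (s' i)) y
      ∂diagGaussian (1 : Fin m → ℝ) ≤ 2 * gaussianComplexity p G := by
  rw [gaussianComplexity_eq]
  set h : (Fin m → Z) → ℝ := fun s =>
    ∫ y, linearSup (m : ℝ)⁻¹ (fun n i => G n (s i)) y ∂diagGaussian (1 : Fin m → ℝ)
  calc _ ≤ ∑ s, ∑ s', p s * p s' * (h s + h s') :=
        Finset.sum_le_sum fun s _ => Finset.sum_le_sum fun s' _ => mul_le_mul_of_nonneg_left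
          (integral_linearSup_sub_le _ (fun _ _ => hG _ _) fun _ _ => hG _ _)
          (mul_pos (hp s) (hp s')).le
    _ = ∑ s, (p s * h s + p s * ∑ s', p s' * h s') := by
        refine Finset.sum_congr rfl fun s _ => ?_
        simp only [mul_add, Finset.sum_add_distrib, mul_assoc, ← Finset.mul_sum, ← Finset.sum_mul,
          hp1, one_mul]
    _ = _ := by
        rw [Finset.sum_add_distrib, ← Finset.sum_mul, hp1]
        ring

/-- Randomisation of an exchangeable pair by the signs of the coordinatewise swaps, followed by
Gaussian domination of these signs. -/
lemma sum_sum_linearSup_le [Nonempty Z] (hp : ∀ z, 0 < p z) (hα : logCoefficient p < 1 / 2)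
    (hG : ∀ n z, |G n z| ≤ L) :
    ∑ s, ∑ s', p s * p s' * linearSup (m : ℝ)⁻¹ (fun n i => G n (s i) - G n (s' i)) (fun _ => 1)
      ≤ 2 / gaussianAbsMoment / √(1 - 2 * logCoefficient p) *
        ∑ s, ∑ s', p s * p s' * ∫ y, linearSup (m : ℝ)⁻¹ (fun n i => G n (s i) - G n (s' i)) y
          ∂diagGaussian (1 : Fin m → ℝ) := by
  have hα' : 0 < 1 - 2 * logCoefficient p := by linarith
  set K := 2 / gaussianAbsMoment / √(1 - 2 * logCoefficient p) with hK
  have hK0 : 0 ≤ K := div_nonneg (div_nonneg two_pos.le gaussianAbsMoment_pos.le) (Real.sqrt_nonneg _)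
  have hK2 : (2 / gaussianAbsMoment) ^ 2 • (fun _ : Fin m => (1 - 2 * logCoefficient p)⁻¹)
      = fun _ => K ^ 2 := by
    ext i
    rw [hK, div_pow _ (√_), Real.sq_sqrt hα'.le]
    rfl
  set Φ : (Fin m → Z) → (Fin m → Z) → (Fin m → ℝ) → ℝ := fun s s' =>
    linearSup (m : ℝ)⁻¹ (fun n i => G n (s i) - G n (s' i)) with hΦ
  have hF : ∀ (s s' : Fin m → Z) n i, |G n (s i) - G n (s' i)| ≤ L + L := fun s s' n i =>
    (abs_sub _ _).trans (add_le_add (hG _ _) (hG _ _))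
  set H : (Fin m → Z) → (Fin m → Z) → ℝ := fun s s' => ∫ y, Φ s s' y ∂diagGaussian (1 : Fin m → ℝ)
    with hH
  have hΦmix : ∀ ε s s', Φ (mix ε s s') (mix ε s' s) (fun _ => 1)
      = Φ s s' fun i => boolSign (ε i) := fun ε s s' => by
    simp only [hΦ, sub_mix, linearSup_mul, mul_one]
  have hHmix : ∀ ε s s', H (mix ε s s') (mix ε s' s) = H s s' := fun ε s s' => by
    simp only [hH, hΦ, sub_mix]
    exact integral_linearSup_mul_sign _ (hF s s') fun i => by cases ε i <;> simp [boolSign]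
  have hcard : (0 : ℝ) < Fintype.card (Fin m → Bool) := Nat.cast_pos.2 Fintype.card_pos
  refine le_of_mul_le_mul_left ?_ hcard
  have h1 := card_mul_sum_sum p fun s s' => Φ s s' fun _ => 1
  have h2 := card_mul_sum_sum p H
  simp only [hΦmix] at h1
  simp only [hHmix] at h2
  rw [mul_left_comm, h1, h2, Finset.mul_sum]
  refine Finset.sum_le_sum fun s _ => ?_
  rw [Finset.mul_sum]
  refine Finset.sum_le_sum fun s' _ => ?_
  have h := sum_swapWeight_le hp hα s s' (convexLipschitz_linearSup (m : ℝ)⁻¹ (hF s s'))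
  rw [hK2, integral_linearSup_diagGaussian_const _ (hF s s') hK0] at h
  rw [← Finset.sum_mul, mul_left_comm]
  exact h

end Symmetrization

/-- There is a universal constant `C > 0` such that, for every random vector `Z` on `𝒵^m`
(with strictly positive pmf `p` and log-coefficient `< 1/2`, the `m` marginals not assumed
identical) and every nonempty countable uniformly bounded class `𝒢 = {G n : n ∈ ℕ}` of
functions `𝒵 → ℝ`,
`E_{S∼Z}[ sup_{g∈𝒢} ( (1/m) ∑ᵢ g(sᵢ) − E_{S∼Z}[(1/m) ∑ᵢ g(sᵢ)] ) ]
  ≤ C 𝔊_Z(𝒢) / √(1 − 2 α_log(Z))`. -/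
theorem expected_sup_le_gaussian_complexity :
    ∃ C : ℝ, 0 < C ∧
      ∀ (Z : Type) [Fintype Z] [Nonempty Z] (m : ℕ), 2 ≤ m →
        ∀ (p : (Fin m → Z) → ℝ), (∀ z, 0 < p z) → (∑ z, p z = 1) →
          logCoefficient p < 1 / 2 →
          ∀ (G : ℕ → Z → ℝ) (L : ℝ), (∀ n z, |G n z| ≤ L) →
            (∑ s, p s * ⨆ n : ℕ,
                ((m : ℝ)⁻¹ * ∑ i, G n (s i) -
                  ∑ s', p s' * ((m : ℝ)⁻¹ * ∑ i, G n (s' i)))) ≤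
              C * gaussianComplexity p G / Real.sqrt (1 - 2 * logCoefficient p) := by
  refine ⟨4 / gaussianAbsMoment, div_pos four_pos gaussianAbsMoment_pos, ?_⟩
  intro Z _ _ m _ p hp hp1 hα G L hG
  refine ((sum_iSup_sub_le hp hp1 hG).trans (sum_sum_linearSup_le hp hα hG)).trans ?_
  refine (mul_le_mul_of_nonneg_left (sum_sum_integral_le hp hp1 hG) (div_nonneg
    (div_nonneg two_pos.le gaussianAbsMoment_pos.le) (Real.sqrt_nonneg _))).trans_eq ?_
  ring
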